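/- Let F be a minor-closed family of finite graphs that does not contain every tree (equivalently, by Robertson–Seymour, F has uniformly bounded pathwidth). Then c1(F) < ∞, i.e., there is a constant c = c(F) such that every shortest-path metric supported on a graph of F embeds into L1 with distortion at most c; equivalently, the multi-commodity max-flow/min-cut gap satisfies gap(F) < ∞. -/

import Mathlib

open scoped BigOperators

/-- A path decomposition of `G` with `t` bags. -/
def IsPathDecomp {V : Type*} (G : SimpleGraph V) (t : ℕ) (X : Fin t → Finset V) : Prop :=
  (∀ v : V, ∃ i, v ∈ X i) ∧
  (∀ ⦃u v : V⦄, G.Adj u v → ∃ i, u ∈ X i ∧ v ∈ X i) ∧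
  (∀ (v : V) (i j l : Fin t), i ≤ j → j ≤ l → v ∈ X i → v ∈ X l → v ∈ X j)

/-- The pathwidth of `G` is at most `k`. -/
def pathwidthLE {V : Type*} (G : SimpleGraph V) (k : ℕ) : Prop :=
  ∃ (t : ℕ) (X : Fin t → Finset V), IsPathDecomp G t X ∧ ∀ i, (X i).card ≤ k + 1

/-- The pathwidth of `G`. -/
noncomputable def pathwidth {V : Type*} (G : SimpleGraph V) : ℕ :=
  sInf {k | pathwidthLE G k}
/-- Shortest-path (pseudo)metric of the metric graph `(G, len)`. -/
noncomputable def spDist {V : Type*} (G : SimpleGraph V) (len : Sym2 V → ℝ) (u v : V) : ℝ :=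
  sInf (Set.range fun w : G.Walk u v => (w.edges.map len).sum)
/-- A finite "metric space": a size `n` together with a distance function on `Fin n`. -/
def FinMetric : Type := (n : ℕ) × (Fin n → Fin n → ℝ)

/-- A family of finite graphs (one set of graphs for each vertex count). -/
def GraphFamily : Type := ∀ n : ℕ, Set (SimpleGraph (Fin n))

/-- The shortest-path metrics supported on (connected) metric graphs from the family `F`. -/
def SupportedMetrics (F : GraphFamily) : Set FinMetric :=
  { Y | ∃ G ∈ F Y.1, G.Connected ∧ ∃ len : Sym2 (Fin Y.1) → ℝ,
      (∀ e, 0 ≤ len e) ∧ ∀ u v, Y.2 u v = spDist G len u v }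
/-- `(X, d)` embeds into `L₁` with distortion at most `c`. -/
def c1LE {X : Type*} [Fintype X] (d : X → X → ℝ) (c : ℝ) : Prop :=
  ∃ (m : ℕ) (f : X → Fin m → ℝ),
    ∀ x y, d x y ≤ (∑ i, |f x i - f y i|) ∧ (∑ i, |f x i - f y i|) ≤ c * d x y
/-- `H` is a minor of `G` (branch-set characterization). -/
def IsMinor {VH VG : Type*} (H : SimpleGraph VH) (G : SimpleGraph VG) : Prop :=
  ∃ A : VH → Set VG,
    (∀ v, (A v).Nonempty) ∧
    (∀ u v, u ≠ v → Disjoint (A u) (A v)) ∧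
    (∀ v, (G.induce (A v)).Connected) ∧
    (∀ ⦃u v⦄, H.Adj u v → ∃ a ∈ A u, ∃ b ∈ A v, G.Adj a b)

section Boundary

open Classical in
/-- The vertices of `X` that are related to some vertex outside `X`. -/
noncomputable def innerBoundary {V : Type*} (R : V → V → Prop) (X : Finset V) : Finset V :=
  X.filter fun a => ∃ y, y ∉ X ∧ R a y

variable {V : Type*} {R : V → V → Prop} {X Y : Finset V}

lemma mem_innerBoundary {a : V} : a ∈ innerBoundary R X ↔ a ∈ X ∧ ∃ y, y ∉ X ∧ R a y := by
  simp [innerBoundary]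

lemma innerBoundary_subset : innerBoundary R X ⊆ X := fun _ h => (mem_innerBoundary.1 h).1

lemma card_innerBoundary_inter_add_union [DecidableEq V] :
    (innerBoundary R (X ∩ Y)).card + (innerBoundary R (X ∪ Y)).card ≤
      (innerBoundary R X).card + (innerBoundary R Y).card := by
  rw [← Finset.card_union_add_card_inter, ← Finset.card_union_add_card_inter (innerBoundary R X)]
  refine add_le_add (Finset.card_le_card fun a ha => ?_) (Finset.card_le_card fun a ha => ?_)
  all_goals
    simp only [Finset.mem_union, Finset.mem_inter, mem_innerBoundary] at ha ⊢
    grind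

lemma innerBoundary_insert_subset [DecidableEq V] (y : V) :
    innerBoundary R (insert y X) ⊆ insert y (innerBoundary R X) := by
  intro a ha
  simp only [mem_innerBoundary, Finset.mem_insert] at ha ⊢
  grind

end Boundary

section Linkage

variable {V : Type*} [Fintype V] [DecidableEq V]

/-- A form of Menger's theorem: if no set between `X` and `Y` has smaller boundary
than `X`, then disjoint connected sets link the boundary of `X` to that of `Y`. -/
lemma exists_linkage (G : SimpleGraph V) (m : ℕ) : ∀ (R : V → V → Prop) (X Y : Finset V),
    (∀ a b, R a b → G.Adj a b) → X ⊆ Y →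
    (∀ Z, X ⊆ Z → Z ⊆ Y → (innerBoundary R X).card ≤ (innerBoundary R Z).card) →
    (Y \ X).card + {p : V × V | R p.1 p.2}.ncard ≤ m →
    ∃ C : V → Set V,
      (∀ a ∈ innerBoundary R X, a ∈ C a ∧ (G.induce (C a)).Connected ∧ (∀ z ∈ C a, z ∈ X → z = a) ∧
        (∀ z ∈ C a, z ∈ Y) ∧ ∃ b ∈ C a, b ∈ innerBoundary R Y) ∧
      (∀ a ∈ innerBoundary R X, ∀ b ∈ innerBoundary R X, a ≠ b → Disjoint (C a) (C b)) := by
  induction m using Nat.strong_induction_on with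
  | _ m ih =>
  intro R X Y hRG hXY hmin hm
  by_cases htight : ∃ Z, X ⊂ Z ∧ Z ⊂ Y ∧ (innerBoundary R Z).card ≤ (innerBoundary R X).card
  · obtain ⟨Z, hXZ, hZY, hZ⟩ := htight
    have h1 : (Z \ X).card < (Y \ X).card := Finset.card_lt_card (by
      constructor
      · exact Finset.sdiff_subset_sdiff hZY.1 le_rfl
      · intro h
        obtain ⟨y, hy, hyZ⟩ := Finset.exists_of_ssubset hZY
        have := h (Finset.mem_sdiff.2 ⟨hy, fun hx => hyZ (hXZ.1 hx)⟩)
        exact hyZ (Finset.mem_sdiff.1 this).1)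
    have h2 : (Y \ Z).card < (Y \ X).card := Finset.card_lt_card (by
      constructor
      · exact Finset.sdiff_subset_sdiff le_rfl hXZ.1
      · intro h
        obtain ⟨y, hy, hyX⟩ := Finset.exists_of_ssubset hXZ
        have := h (Finset.mem_sdiff.2 ⟨hZY.1 hy, hyX⟩)
        exact (Finset.mem_sdiff.1 this).2 hy)
    obtain ⟨C₁, hC₁, hd₁⟩ := ih _ (lt_of_lt_of_le (by omega) hm) R X Z hRG hXZ.1
      (fun W h h' => hmin W h (h'.trans hZY.1)) le_rfl
    obtain ⟨C₂, hC₂, hd₂⟩ := ih _ (lt_of_lt_of_le (by omega) hm) R Z Y hRG hZY.1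
      (fun W h h' => hZ.trans (hmin W (hXZ.1.trans h) h')) le_rfl
    choose! b hbC hbZ using fun a ha => (hC₁ a ha).2.2.2.2
    have hcross : ∀ a ∈ innerBoundary R X, ∀ a' ∈ innerBoundary R X, a ≠ a' →
        Disjoint (C₁ a) (C₂ (b a')) := by
      intro a ha a' ha' hne
      rw [Set.disjoint_left]
      intro z hz hz'
      have hzb := (hC₂ _ (hbZ a' ha')).2.2.1 z hz' ((hC₁ a ha).2.2.2.1 z hz)
      subst hzb
      exact Set.disjoint_left.1 (hd₁ a ha a' ha' hne) hz (hbC a' ha')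
    refine ⟨fun a => C₁ a ∪ C₂ (b a), fun a ha => ⟨Or.inl (hC₁ a ha).1, ?_, ?_, ?_, ?_⟩, ?_⟩
    · exact SimpleGraph.induce_union_connected (hC₁ a ha).2.1.preconnected
        (hC₂ _ (hbZ a ha)).2.1.preconnected ⟨b a, hbC a ha, (hC₂ _ (hbZ a ha)).1⟩
    · rintro z (hz | hz) hzX
      · exact (hC₁ a ha).2.2.1 z hz hzX
      · have := (hC₂ _ (hbZ a ha)).2.2.1 z hz (hXZ.1 hzX)
        subst this
        exact (hC₁ a ha).2.2.1 _ (hbC a ha) hzX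
    · rintro z (hz | hz)
      · exact hZY.1 ((hC₁ a ha).2.2.2.1 z hz)
      · exact (hC₂ _ (hbZ a ha)).2.2.2.1 z hz
    · obtain ⟨c, hc, hc'⟩ := (hC₂ _ (hbZ a ha)).2.2.2.2
      exact ⟨c, Or.inr hc, hc'⟩
    · intro a ha a' ha' hne
      have hbne : b a ≠ b a' := fun h =>
        Set.disjoint_left.1 (hd₁ a ha a' ha' hne) (hbC a ha) (h ▸ hbC a' ha')
      simp only [Set.disjoint_union_left, Set.disjoint_union_right]
      exact ⟨⟨hd₁ a ha a' ha' hne, (hcross a' ha' a ha hne.symm).symm⟩, hcross a ha a' ha' hne,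
        hd₂ _ (hbZ a ha) _ (hbZ a' ha') hbne⟩
  · push Not at htight
    by_cases hout : ∃ a ∈ innerBoundary R X, ∃ y ∈ Y \ X, R a y
    · obtain ⟨a₀, ha₀, y, hy, hay⟩ := hout
      obtain ⟨hyY, hyX⟩ := Finset.mem_sdiff.1 hy
      have ha₀X := innerBoundary_subset ha₀
      have hya : y ≠ a₀ := fun h => hyX (h ▸ ha₀X)
      by_cases hother : ∃ z, z ∉ X ∧ R a₀ z ∧ z ≠ y
      · -- delete the pair `(a₀, y)`
        obtain ⟨z₀, hz₀X, hz₀, hz₀y⟩ := hother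
        let R' : V → V → Prop := fun a b => R a b ∧ ¬ (a = a₀ ∧ b = y)
        have hsub : ∀ Z, innerBoundary R' Z ⊆ innerBoundary R Z := by
          intro Z a ha
          rw [mem_innerBoundary] at ha ⊢
          exact ⟨ha.1, ha.2.imp fun _ h => ⟨h.1, h.2.1⟩⟩
        have hX' : innerBoundary R' X = innerBoundary R X := by
          refine (hsub X).antisymm fun a ha => ?_
          rw [mem_innerBoundary] at ha ⊢
          obtain ⟨haX, w, hw, haw⟩ := ha
          by_cases h : a = a₀ ∧ w = y
          · exact ⟨haX, z₀, hz₀X, h.1 ▸ hz₀, fun h' => hz₀y h'.2⟩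
          · exact ⟨haX, w, hw, haw, h⟩
        have hin : ∀ Z, y ∈ Z → innerBoundary R Z ⊆ innerBoundary R' Z := by
          intro Z hyZ a ha
          rw [mem_innerBoundary] at ha ⊢
          obtain ⟨haX, w, hw, haw⟩ := ha
          exact ⟨haX, w, hw, haw, fun h => hw (h.2 ▸ hyZ)⟩
        have hgen : ∀ Z, innerBoundary R Z ⊆ insert a₀ (innerBoundary R' Z) := by
          intro Z a ha
          rw [Finset.mem_insert, mem_innerBoundary]
          rw [mem_innerBoundary] at ha
          obtain ⟨haX, w, hw, haw⟩ := ha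
          by_cases h : a = a₀
          · exact Or.inl h
          · exact Or.inr ⟨haX, w, hw, haw, fun h' => h h'.1⟩
        have hmin' : ∀ Z, X ⊆ Z → Z ⊆ Y →
            (innerBoundary R' X).card ≤ (innerBoundary R' Z).card := by
          intro Z hXZ hZY
          rw [hX']
          rcases hXZ.eq_or_ssubset with rfl | hXZ'
          · rw [hX']
          rcases hZY.eq_or_ssubset with rfl | hZY'
          · exact (hmin Z hXZ le_rfl).trans (Finset.card_le_card (hin Z hyY))
          · have h1 := htight Z hXZ' hZY'
            have h2 := (Finset.card_le_card (hgen Z)).trans (Finset.card_insert_le _ _)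
            omega
        have hcard : {p : V × V | R' p.1 p.2}.ncard < {p : V × V | R p.1 p.2}.ncard := by
          refine Set.ncard_lt_ncard ⟨fun p hp => hp.1, fun h => ?_⟩ (Set.toFinite _)
          exact (@h (a₀, y) hay).2 ⟨rfl, rfl⟩
        obtain ⟨C, hC, hd⟩ := ih _ (lt_of_lt_of_le (by omega) hm) R' X Y
          (fun a b h => hRG a b h.1) hXY hmin' le_rfl
        rw [hX'] at hC hd
        refine ⟨C, fun a ha => ?_, hd⟩
        obtain ⟨h1, h2, h3, h4, c, hc, hc'⟩ := hC a ha
        exact ⟨h1, h2, h3, h4, c, hc, hsub Y hc'⟩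
      · -- `y` replaces `a₀`
        push Not at hother
        have hsub : innerBoundary R (insert y X) ⊆ insert y ((innerBoundary R X).erase a₀) := by
          intro a ha
          rw [mem_innerBoundary] at ha
          simp only [Finset.mem_insert, Finset.mem_erase, mem_innerBoundary, not_or] at ha ⊢
          obtain ⟨haX, w, ⟨hwy, hwX⟩, haw⟩ := ha
          rcases haX with h | h
          · exact Or.inl h
          · exact Or.inr ⟨fun h' => hwy (hother w hwX (h' ▸ haw)), h, w, hwX, haw⟩
        have hXY' : insert y X ⊆ Y := Finset.insert_subset hyY hXY
        have hcard : (insert y ((innerBoundary R X).erase a₀)).card ≤ (innerBoundary R X).card := by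
          have h1 := Finset.card_insert_le y ((innerBoundary R X).erase a₀)
          have h2 := Finset.card_erase_add_one ha₀
          omega
        have heq := Finset.eq_of_subset_of_card_le hsub
          (hcard.trans (hmin _ (Finset.subset_insert _ _) hXY'))
        have hlt : (Y \ insert y X).card < (Y \ X).card := Finset.card_lt_card (by
          refine ⟨Finset.sdiff_subset_sdiff le_rfl (Finset.subset_insert _ _), fun h => ?_⟩
          have := h hy
          simp at this)
        obtain ⟨C, hC, hd⟩ := ih _ (lt_of_lt_of_le (by omega) hm) R (insert y X) Y hRG hXY'
          (fun Z h h' => by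
            rw [heq]
            exact hcard.trans (hmin Z ((Finset.subset_insert _ _).trans h) h')) le_rfl
        rw [heq] at hC hd
        have hyB : y ∈ insert y ((innerBoundary R X).erase a₀) := Finset.mem_insert_self _ _
        have haB : ∀ a ∈ innerBoundary R X, a ≠ a₀ →
            a ∈ insert y ((innerBoundary R X).erase a₀) := fun a ha h =>
          Finset.mem_insert_of_mem (Finset.mem_erase.2 ⟨h, ha⟩)
        have hne : ∀ a ∈ innerBoundary R X, a ≠ y := fun a ha h =>
          hyX (h ▸ innerBoundary_subset ha)
        have hnot : ∀ a ∈ innerBoundary R X, a ≠ a₀ → a₀ ∉ C a := fun a ha h h' =>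
          h ((hC a (haB a ha h)).2.2.1 a₀ h' (Finset.mem_insert_of_mem ha₀X)).symm
        obtain ⟨C', hC'₀, hC'⟩ : ∃ C' : V → Set V, C' a₀ = {a₀} ∪ C y ∧ ∀ a, a ≠ a₀ → C' a = C a :=
          ⟨Function.update C a₀ ({a₀} ∪ C y), Function.update_self .., fun a h =>
            Function.update_of_ne h ..⟩
        refine ⟨C', fun a ha => ?_, ?_⟩
        · by_cases h : a = a₀
          · subst h
            rw [hC'₀]
            obtain ⟨h1, h2, h3, h4, c, hc, hc'⟩ := hC y hyB
            refine ⟨Or.inl rfl, ?_, ?_, ?_, c, Or.inr hc, hc'⟩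
            · exact SimpleGraph.connected_induce_union (v := a) (w := y) (s := {a})
                (SimpleGraph.Preconnected.of_subsingleton) h2.preconnected rfl h1
                (hRG _ _ hay)
            · rintro z (hz | hz) hzX
              · exact hz
              · exact absurd (h3 z hz (Finset.mem_insert_of_mem hzX)) fun h => hyX (h ▸ hzX)
            · rintro z (hz | hz)
              · exact hz ▸ hXY ha₀X
              · exact h4 z hz
          · rw [hC' a h]
            obtain ⟨h1, h2, h3, h4, h5⟩ := hC a (haB a ha h)
            exact ⟨h1, h2, fun z hz hzX => h3 z hz (Finset.mem_insert_of_mem hzX), h4, h5⟩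
        · intro a ha b hb hab
          by_cases h : a = a₀
          · subst h
            have hb' : b ≠ a := hab.symm
            rw [hC'₀, hC' b hb', Set.disjoint_union_left, Set.disjoint_singleton_left]
            exact ⟨hnot b hb hb', hd y hyB b (haB b hb hb') (hne b hb).symm⟩
          · by_cases h' : b = a₀
            · subst h'
              rw [hC'₀, hC' a h, Set.disjoint_union_right, Set.disjoint_singleton_right]
              exact ⟨hnot a ha h, hd a (haB a ha h) y hyB (hne a ha)⟩
            · rw [hC' a h, hC' b h']
              exact hd a (haB a ha h) b (haB b hb h') hab
    · push Not at hout
      refine ⟨fun a => {a}, fun a ha => ⟨rfl, ?_, fun z hz _ => hz, ?_, a, rfl, ?_⟩, ?_⟩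
      · have : Subsingleton ({a} : Set V) := inferInstance
        exact ⟨SimpleGraph.Preconnected.of_subsingleton⟩
      · rintro z rfl
        exact hXY (innerBoundary_subset ha)
      · obtain ⟨haX, y, hy, hay⟩ := mem_innerBoundary.1 ha
        exact mem_innerBoundary.2 ⟨hXY haX, y, fun h =>
          hout a ha y (Finset.mem_sdiff.2 ⟨h, hy⟩) hay, hay⟩
      · intro a _ b _ h
        simpa using h

end Linkage
section Sweep

variable {V : Type*} [DecidableEq V]

/-- `Sweep R k X Y`: the set `X` grows to `Y` one vertex at a time while all the later sets have
boundary of size at most `k`. -/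
inductive Sweep (R : V → V → Prop) (k : ℕ) (X : Finset V) : Finset V → Prop
  | refl : Sweep R k X X
  | insert {Y : Finset V} {y : V} : Sweep R k X Y → y ∉ Y →
      (innerBoundary R (insert y Y)).card ≤ k → Sweep R k X (insert y Y)

variable {R : V → V → Prop} {k : ℕ} {X Y Z : Finset V}

lemma Sweep.trans (h : Sweep R k X Y) (h' : Sweep R k Y Z) : Sweep R k X Z := by
  induction h' with
  | refl => exact h
  | insert _ hy hk ih => exact ih.insert hy hk

lemma Sweep.subset (h : Sweep R k X Y) : X ⊆ Y := by
  induction h with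
  | refl => exact le_rfl
  | insert _ _ _ ih => exact ih.trans (Finset.subset_insert _ _)

/-- A sweep from `X` to `Y` restricts to a set `Z` of minimum boundary between them. -/
lemma Sweep.inter (h : Sweep R k X Y) (hXZ : X ⊆ Z) :
    (∀ W, Z ⊆ W → W ⊆ Y ∪ Z → (innerBoundary R Z).card ≤ (innerBoundary R W).card) →
    Sweep R k X (Y ∩ Z) := by
  induction h with
  | refl =>
    intro _
    rw [Finset.inter_eq_left.2 hXZ]
    exact .refl
  | @insert Y y _ hy hk ih =>
    intro hmin
    have ih' := ih fun W h h' => hmin W h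
      (h'.trans (Finset.union_subset_union (Finset.subset_insert _ _) le_rfl))
    by_cases hyZ : y ∈ Z
    · have h1 := card_innerBoundary_inter_add_union (R := R) (X := Insert.insert y Y) (Y := Z)
      have h2 := hmin (Insert.insert y Y ∪ Z) Finset.subset_union_right le_rfl
      rw [Finset.insert_inter_of_mem hyZ] at h1 ⊢
      exact ih'.insert (fun h => hy (Finset.mem_inter.1 h).1) (by omega)
    · rwa [Finset.insert_inter_of_notMem hyZ]

/-- A sweep of the whole vertex set yields an interval representation of small overlap. -/
lemma Sweep.exists_rank (h : Sweep R k ∅ Y) :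
    ∃ (r : V → ℕ) (N : ℕ), (∀ v ∈ Y, r v < N) ∧ (∀ u ∈ Y, ∀ v ∈ Y, r u = r v → u = v) ∧
      ∀ t, (innerBoundary R (Y.filter fun v => r v < t)).card ≤ k := by
  induction h with
  | refl => exact ⟨fun _ => 0, 0, by simp, by simp, fun t => by simp [innerBoundary]⟩
  | @insert Y y _ hy hk ih =>
    obtain ⟨r, N, hN, hinj, hr⟩ := ih
    have hne : ∀ v ∈ Y, v ≠ y := fun v hv h => hy (h ▸ hv)
    refine ⟨Function.update r y N, N + 1, ?_, ?_, fun t => ?_⟩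
    · intro v hv
      rcases Finset.mem_insert.1 hv with rfl | hv
      · simp
      · rw [Function.update_of_ne (hne v hv)]
        exact (hN v hv).trans (Nat.lt_succ_self N)
    · intro u hu v hv huv
      rcases Finset.mem_insert.1 hu with hu' | hu' <;> rcases Finset.mem_insert.1 hv with hv' | hv'
      · exact hu'.trans hv'.symm
      · rw [hu', Function.update_self, Function.update_of_ne (hne v hv')] at huv
        exact absurd (hN v hv') (by omega)
      · rw [hv', Function.update_self, Function.update_of_ne (hne u hu')] at huv
        exact absurd (hN u hu') (by omega)
      · rw [Function.update_of_ne (hne v hv'), Function.update_of_ne (hne u hu')] at huv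
        exact hinj u hu' v hv' huv
    · rcases le_or_gt t N with ht | ht
      · convert hr t using 3
        ext v
        simp only [Finset.mem_filter, Finset.mem_insert]
        constructor
        · rintro ⟨rfl | hv, h⟩
          · rw [Function.update_self] at h
            omega
          · rw [Function.update_of_ne (hne v hv)] at h
            exact ⟨hv, h⟩
        · rintro ⟨hv, h⟩
          rw [Function.update_of_ne (hne v hv)]
          exact ⟨Or.inr hv, h⟩
      · convert hk using 3
        rw [Finset.filter_eq_self]
        intro v hv
        rcases Finset.mem_insert.1 hv with rfl | hv
        · simpa using ht
        · rw [Function.update_of_ne (hne v hv)]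
          exact (hN v hv).trans ht

end Sweep

section TreeMinor

/-- A vertex outside a connected set of an acyclic graph has at most one neighbour in it. -/
lemma SimpleGraph.IsAcyclic.eq_of_adj_of_induce_preconnected {W : Type*} {T : SimpleGraph W}
    (hT : T.IsAcyclic) {S : Set W} (hS : (T.induce S).Preconnected) {t p q : W} (ht : t ∉ S)
    (hp : p ∈ S) (hq : q ∈ S) (hpt : T.Adj t p) (hqt : T.Adj t q) : p = q := by
  classical
  obtain ⟨w, hw, hwS⟩ : ∃ w : T.Walk p q, w.IsPath ∧ ∀ x ∈ w.support, x ∈ S := by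
    have aux : ∀ (a b : S), (T.induce S).Walk a b →
        ∃ w : T.Walk a b, ∀ x ∈ w.support, x ∈ S := by
      intro a b w
      induction w with
      | @nil a => exact ⟨.nil, by simp⟩
      | @cons a c d h _ ih =>
        obtain ⟨w, hw⟩ := ih
        refine ⟨.cons h w, fun x hx => ?_⟩
        rcases List.mem_cons.1 hx with rfl | hx
        · exact a.2
        · exact hw x hx
    obtain ⟨w⟩ := hS ⟨p, hp⟩ ⟨q, hq⟩
    obtain ⟨w, hw⟩ := aux _ _ w
    exact ⟨w.bypass, w.bypass_isPath, fun x hx => hw x (w.support_bypass_subset_support hx)⟩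
  have hcons : (SimpleGraph.Walk.cons hpt w).IsPath :=
    SimpleGraph.Walk.cons_isPath_iff _ _ |>.2 ⟨hw, fun h => ht (hwS t h)⟩
  have := hT.eq_snd_of_adj_start hcons hqt (SimpleGraph.Walk.end_mem_support _)
  simpa using this.symm

variable {V : Type*} [Fintype V] [DecidableEq V]

/-- A graph that cannot be swept with boundaries of size at most `n` contains every tree on `n`
vertices as a minor. -/
lemma isMinor_of_not_sweep (G : SimpleGraph V) {n : ℕ} (T : SimpleGraph (Fin n)) (hT : T.IsTree)
    (hG : ¬ Sweep G.Adj n ∅ Finset.univ) : IsMinor T G := by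
  have : Nonempty V := by
    by_contra h
    rw [not_nonempty_iff] at h
    exact hG (Finset.univ_eq_empty (α := V) ▸ .refl)
  have hext : ∀ (X : Finset V) (i : ℕ), (innerBoundary G.Adj X).card ≤ i →
      ∃ Y, Sweep G.Adj n X Y ∧ (innerBoundary G.Adj Y).card ≤ i ∧
        ∀ Z, Y ⊂ Z → Sweep G.Adj n Y Z → i < (innerBoundary G.Adj Z).card := by
    classical
    intro X i hX
    obtain ⟨Y, hY, hmax⟩ := Finset.exists_maximal (s := Finset.univ.filter fun Y =>
      Sweep G.Adj n X Y ∧ (innerBoundary G.Adj Y).card ≤ i) ⟨X, by simpa using ⟨.refl, hX⟩⟩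
    simp only [Finset.mem_filter, Finset.mem_univ, true_and] at hY hmax
    refine ⟨Y, hY.1, hY.2, fun Z hYZ hZ => ?_⟩
    by_contra! hcon
    exact hYZ.2 (hmax ⟨hY.1.trans hZ, hcon⟩ hYZ.1)
  have key : ∀ i ≤ n, ∃ (S : Finset (Fin n)) (X : Finset V) (A : Fin n → Set V),
      S.card = i ∧ (T.induce (S : Set (Fin n))).Preconnected ∧ Sweep G.Adj n ∅ X ∧
      (innerBoundary G.Adj X).card ≤ i ∧
      (∀ Z, X ⊂ Z → Sweep G.Adj n X Z → i < (innerBoundary G.Adj Z).card) ∧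
      (∀ s ∈ S, (G.induce (A s)).Connected ∧ (∀ z ∈ A s, z ∈ X) ∧
        ∃ b ∈ A s, b ∈ innerBoundary G.Adj X) ∧
      (∀ s ∈ S, ∀ t ∈ S, s ≠ t → Disjoint (A s) (A t)) ∧
      (∀ s ∈ S, ∀ t ∈ S, T.Adj s t → ∃ a ∈ A s, ∃ b ∈ A t, G.Adj a b) := by
    intro i
    induction i with
    | zero =>
      intro _
      obtain ⟨X, h1, h2, h3⟩ := hext ∅ 0 (by simp [innerBoundary])
      exact ⟨∅, X, fun _ => ∅, rfl, fun x => absurd x.2 (by simp), h1, h2, h3, by simp, by simp,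
        by simp⟩
    | succ i ih =>
      intro hi
      obtain ⟨S, X, A, hScard, hSconn, hX, hXi, hXmax, hA, hAdisj, hAadj⟩ := ih (by omega)
      choose! b hbA hbX using fun s hs => (hA s hs).2.2
      -- the new tree vertex `t` and the vertex `y` of `G` that starts its branch set
      have hstep : ∃ t ∉ S, ∃ y ∉ X, (T.induce ((insert t S : Finset (Fin n)) : Set (Fin n))).Preconnected
          ∧ ∀ s ∈ S, T.Adj t s → G.Adj y (b s) := by
        rcases S.eq_empty_or_nonempty with rfl | hSne
        · have hXne : X ≠ Finset.univ := by
            rintro rfl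
            exact hG hX
          obtain ⟨y, hy⟩ : ∃ y, y ∉ X := by
            by_contra! h
            exact hXne (Finset.eq_univ_iff_forall.2 h)
          refine ⟨⟨0, by omega⟩, by simp, y, hy, ?_, by simp⟩
          have : Subsingleton ((insert (⟨0, by omega⟩ : Fin n) ∅ : Finset (Fin n)) : Set (Fin n)) := by
            simp only [insert_empty_eq, Finset.coe_singleton]
            infer_instance
          exact SimpleGraph.Preconnected.of_subsingleton
        · obtain ⟨s₀, hs₀⟩ := hSne
          obtain ⟨t₀, ht₀⟩ : ∃ t, t ∉ S := by
            by_contra! h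
            rw [Finset.eq_univ_iff_forall.2 h, Finset.card_univ, Fintype.card_fin] at hScard
            omega
          obtain ⟨w⟩ := hT.1.preconnected s₀ t₀
          obtain ⟨d, -, hd1, hd2⟩ := w.exists_boundary_dart (S : Set (Fin n)) hs₀ ht₀
          obtain ⟨-, y, hy, hay⟩ := mem_innerBoundary.1 (hbX _ hd1)
          refine ⟨d.snd, hd2, y, hy, ?_, fun s hs hst => ?_⟩
          · have := (SimpleGraph.connected_induce_union (s := (S : Set (Fin n))) (t := {d.snd})
              hSconn SimpleGraph.Preconnected.of_subsingleton hd1 rfl d.adj).preconnected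
            rwa [Finset.coe_insert, Set.insert_eq, Set.union_comm]
          · rw [hT.2.eq_of_adj_of_induce_preconnected hSconn hd2 hs hd1 hst d.adj.symm]
            exact hay.symm
      obtain ⟨t, htS, y, hyX, hconn, hyadj⟩ := hstep
      have hins := Finset.card_le_card (innerBoundary_insert_subset (R := G.Adj) (X := X) y)
      have hins' := Finset.card_insert_le y (innerBoundary G.Adj X)
      have hXs : Sweep G.Adj n X (insert y X) := Sweep.refl.insert hyX (by omega)
      have hgt := hXmax _ (Finset.ssubset_insert hyX) hXs
      have hbd : innerBoundary G.Adj (insert y X) = insert y (innerBoundary G.Adj X) :=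
        Finset.eq_of_subset_of_card_le (innerBoundary_insert_subset y) (by omega)
      obtain ⟨Y, hY, hYi, hYmax⟩ := hext (insert y X) (i + 1) (by omega)
      have hmin : ∀ Z, insert y X ⊆ Z → Z ⊆ Y →
          (innerBoundary G.Adj (insert y X)).card ≤ (innerBoundary G.Adj Z).card := by
        classical
        by_contra! hcon
        obtain ⟨Z, hZ1, hZ2, hZ3⟩ := hcon
        obtain ⟨Z₀, hZ₀, hZ₀min⟩ := Finset.exists_min_image (Finset.univ.filter fun Z =>
          insert y X ⊆ Z ∧ Z ⊆ Y) (fun Z => (innerBoundary G.Adj Z).card)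
          ⟨Z, by simpa using ⟨hZ1, hZ2⟩⟩
        simp only [Finset.mem_filter, Finset.mem_univ, true_and] at hZ₀ hZ₀min
        have hle := hZ₀min Z ⟨hZ1, hZ2⟩
        have hsw : Sweep G.Adj n (insert y X) (Y ∩ Z₀) := hY.inter hZ₀.1 fun W h h' =>
          hZ₀min W ⟨hZ₀.1.trans h, h'.trans (Finset.union_subset le_rfl hZ₀.2)⟩
        rw [Finset.inter_eq_right.2 hZ₀.2] at hsw
        have := hXmax Z₀ ((Finset.ssubset_insert hyX).trans_subset hZ₀.1) (hXs.trans hsw)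
        omega
      obtain ⟨C, hC, hCd⟩ := exists_linkage G _ G.Adj (insert y X) Y (fun _ _ h => h) hY.subset hmin
        le_rfl
      rw [hbd] at hC hCd
      have hyB : y ∈ insert y (innerBoundary G.Adj X) := Finset.mem_insert_self _ _
      have hbB : ∀ s ∈ S, b s ∈ insert y (innerBoundary G.Adj X) := fun s hs =>
        Finset.mem_insert_of_mem (hbX s hs)
      have hby : ∀ s ∈ S, b s ≠ y := fun s hs h => hyX (h ▸ innerBoundary_subset (hbX s hs))
      have hAC : ∀ s ∈ S, ∀ c ∈ insert y (innerBoundary G.Adj X), c ∉ A s → Disjoint (A s) (C c) := by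
        intro s hs c hc hcA
        rw [Set.disjoint_left]
        intro z hz hz'
        exact hcA ((hC c hc).2.2.1 z hz' (Finset.mem_insert_of_mem ((hA s hs).2.1 z hz)) ▸ hz)
      have hyA : ∀ s ∈ S, y ∉ A s := fun s hs h => hyX ((hA s hs).2.1 y h)
      obtain ⟨A', hA't, hA'⟩ : ∃ A' : Fin n → Set V, A' t = C y ∧
          ∀ s ∈ S, A' s = A s ∪ C (b s) :=
        ⟨Function.update (fun s => A s ∪ C (b s)) t (C y), Function.update_self ..,
          fun s hs => Function.update_of_ne (fun h : s = t => htS (h ▸ hs)) ..⟩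
      have hdt : ∀ s ∈ S, Disjoint (A' s) (A' t) := by
        intro s hs
        rw [hA' s hs, hA't, Set.disjoint_union_left]
        exact ⟨hAC s hs y hyB (hyA s hs), hCd _ (hbB s hs) _ hyB (hby s hs)⟩
      refine ⟨insert t S, Y, A', by rw [Finset.card_insert_of_notMem htS, hScard], hconn,
        (hX.trans hXs).trans hY, hYi, hYmax, fun s hs => ?_, ?_, ?_⟩
      · rcases Finset.mem_insert.1 hs with rfl | hs
        · rw [hA't]
          exact ⟨(hC y hyB).2.1, (hC y hyB).2.2.2.1, (hC y hyB).2.2.2.2⟩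
        · rw [hA' s hs]
          obtain ⟨h1, h2, -, h4, c, hc, hc'⟩ := hC _ (hbB s hs)
          refine ⟨SimpleGraph.induce_union_connected (hA s hs).1.preconnected h2.preconnected
            ⟨b s, hbA s hs, h1⟩, ?_, c, Or.inr hc, hc'⟩
          rintro z (hz | hz)
          · exact hY.subset (Finset.mem_insert_of_mem ((hA s hs).2.1 z hz))
          · exact h4 z hz
      · intro s hsi s' hsi' hne
        rcases Finset.mem_insert.1 hsi with rfl | hs <;>
          rcases Finset.mem_insert.1 hsi' with rfl | hs'
        · exact absurd rfl hne
        · exact (hdt _ hs').symm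
        · exact hdt _ hs
        · have hd := hAdisj s hs s' hs' hne
          have h1 : b s' ∉ A s := fun h => Set.disjoint_left.1 hd h (hbA s' hs')
          have h2 : b s ∉ A s' := fun h => Set.disjoint_left.1 hd (hbA s hs) h
          have h3 : b s ≠ b s' := fun h => h1 (h ▸ hbA s hs)
          rw [hA' s hs, hA' s' hs', Set.disjoint_union_left, Set.disjoint_union_right,
            Set.disjoint_union_right]
          exact ⟨⟨hd, hAC s hs _ (hbB s' hs') h1⟩, (hAC s' hs' _ (hbB s hs) h2).symm,
            hCd _ (hbB s hs) _ (hbB s' hs') h3⟩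
      · intro s hsi s' hsi' hadj
        rcases Finset.mem_insert.1 hsi with rfl | hs <;>
          rcases Finset.mem_insert.1 hsi' with rfl | hs'
        · exact absurd hadj (T.irrefl)
        · exact ⟨y, hA't ▸ (hC y hyB).1, b s', by rw [hA' s' hs']; exact Or.inl (hbA s' hs'),
            hyadj s' hs' hadj⟩
        · exact ⟨b s, by rw [hA' s hs]; exact Or.inl (hbA s hs), y, hA't ▸ (hC y hyB).1,
            (hyadj s hs hadj.symm).symm⟩
        · obtain ⟨a, ha, c, hc, hac⟩ := hAadj s hs s' hs' hadj
          exact ⟨a, by rw [hA' s hs]; exact Or.inl ha, c, by rw [hA' s' hs']; exact Or.inl hc, hac⟩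
  obtain ⟨S, X, A, hScard, -, -, -, -, hA, hAdisj, hAadj⟩ := key n le_rfl
  have hS : ∀ s, s ∈ S := by
    rw [← Finset.eq_univ_iff_forall, ← Finset.card_eq_iff_eq_univ, hScard, Fintype.card_fin]
  exact ⟨A, fun v => (hA v (hS v)).2.2.imp fun _ h => h.1,
    fun u v huv => hAdisj u (hS u) v (hS v) huv, fun v => (hA v (hS v)).1,
    fun u v huv => hAadj u (hS u) v (hS v) huv⟩

/-- An interval representation of `G` in which every point lies in at most `m` intervals. -/
structure IsIntervalRep (G : SimpleGraph V) (l r : V → ℕ) (m : ℕ) : Prop where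
  le : ∀ v, l v ≤ r v
  adj : ∀ u v, G.Adj u v → l u ≤ r v
  card_le : ∀ t, {v | l v ≤ t ∧ t ≤ r v}.ncard ≤ m

lemma exists_isIntervalRep (G : SimpleGraph V) {n : ℕ} (T : SimpleGraph (Fin n)) (hT : T.IsTree)
    (hG : ¬ IsMinor T G) : ∃ l r : V → ℕ, IsIntervalRep G l r (n + 1) := by
  classical
  have hsw : Sweep G.Adj n ∅ Finset.univ := by
    by_contra h
    exact hG (isMinor_of_not_sweep G T hT h)
  obtain ⟨l, N, hN, hinj, hl⟩ := hsw.exists_rank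
  refine ⟨l, fun v => (Finset.univ.filter fun u => u = v ∨ G.Adj v u).sup l, ?_, ?_, fun t => ?_⟩
  · intro v
    exact Finset.le_sup (f := l) (by simp)
  · intro u v huv
    exact Finset.le_sup (f := l) (by simp [huv.symm])
  · have hsub : {v | l v ≤ t ∧ t ≤ (Finset.univ.filter fun u => u = v ∨ G.Adj v u).sup l} ⊆
        ((innerBoundary G.Adj (Finset.univ.filter fun v => l v < t) : Finset V) : Set V) ∪
          {v | l v = t} := by
      rintro v ⟨h1, h2⟩
      rcases h1.eq_or_lt with h | h
      · exact Or.inr h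
      · refine Or.inl (Finset.mem_coe.2 (mem_innerBoundary.2 ⟨by simpa using h, ?_⟩))
        obtain ⟨u, hu, hut⟩ := (Finset.le_sup_iff (by simpa using (Nat.zero_le _).trans_lt h)).1 h2
        rcases (Finset.mem_filter.1 hu).2 with rfl | hadj
        · omega
        · exact ⟨u, by simpa using hut, hadj⟩
    have h1 : {v | l v = t}.ncard ≤ 1 := by
      rw [Set.ncard_le_one]
      rintro a rfl b hb
      exact hinj a (Finset.mem_univ _) b (Finset.mem_univ _) hb.symm
    refine (Set.ncard_le_ncard hsub (Set.toFinite _)).trans ((Set.ncard_union_le _ _).trans ?_)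
    rw [Set.ncard_coe_finset]
    exact add_le_add (hl t) h1

end TreeMinor
section ShortestPath

variable {V : Type*} {G H : SimpleGraph V} {len : Sym2 V → ℝ}

lemma sum_map_len_nonneg (hlen : ∀ e, 0 ≤ len e) (l : List (Sym2 V)) : 0 ≤ (l.map len).sum :=
  List.sum_nonneg fun x hx => by
    obtain ⟨e, -, rfl⟩ := List.mem_map.1 hx
    exact hlen e

lemma spDist_le_walk (hlen : ∀ e, 0 ≤ len e) {u v : V} (w : G.Walk u v) :
    spDist G len u v ≤ (w.edges.map len).sum :=
  csInf_le ⟨0, by rintro _ ⟨w, rfl⟩; exact sum_map_len_nonneg hlen _⟩ ⟨w, rfl⟩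

lemma spDist_nonneg (hlen : ∀ e, 0 ≤ len e) (u v : V) : 0 ≤ spDist G len u v :=
  Real.sInf_nonneg (by rintro _ ⟨w, rfl⟩; exact sum_map_len_nonneg hlen _)

lemma exists_walk_eq_spDist [Finite V] (hlen : ∀ e, 0 ≤ len e) {u v : V} (h : G.Reachable u v) :
    ∃ w : G.Walk u v, (w.edges.map len).sum = spDist G len u v := by
  classical
  have := Fintype.ofFinite V
  obtain ⟨w₀⟩ := h
  have : Nonempty (G.Path u v) := ⟨w₀.toPath⟩
  obtain ⟨p, hp⟩ := Finite.exists_min fun p : G.Path u v => (p.1.edges.map len).sum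
  refine ⟨p.1, le_antisymm (le_csInf ⟨_, w₀, rfl⟩ ?_) (spDist_le_walk hlen _)⟩
  rintro _ ⟨w, rfl⟩
  refine (hp w.toPath).trans ?_
  refine List.Sublist.sum_le_sum (w.edges_bypass_sublist_edges.map len) fun x hx => ?_
  obtain ⟨e, -, rfl⟩ := List.mem_map.1 hx
  exact hlen e

lemma spDist_triangle [Finite V] (hlen : ∀ e, 0 ≤ len e) {u v x : V} (h : G.Reachable u v)
    (h' : G.Reachable v x) : spDist G len u x ≤ spDist G len u v + spDist G len v x := by
  obtain ⟨w, hw⟩ := exists_walk_eq_spDist hlen h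
  obtain ⟨w', hw'⟩ := exists_walk_eq_spDist hlen h'
  rw [← hw, ← hw']
  simpa using spDist_le_walk hlen (w.append w')

lemma spDist_comm (u v : V) : spDist G len u v = spDist G len v u := by
  unfold spDist
  congr 1
  ext x
  constructor
  all_goals
    rintro ⟨w, rfl⟩
    exact ⟨w.reverse, by simp⟩

lemma spDist_self (hlen : ∀ e, 0 ≤ len e) (u : V) : spDist G len u u = 0 :=
  le_antisymm (by simpa using spDist_le_walk hlen (.nil : G.Walk u u)) (spDist_nonneg hlen _ _)

lemma spDist_le_len (hlen : ∀ e, 0 ≤ len e) {u v : V} (h : G.Adj u v) :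
    spDist G len u v ≤ len s(u, v) := by
  simpa using spDist_le_walk hlen (.cons h .nil : G.Walk u v)

lemma spDist_anti [Finite V] (hlen : ∀ e, 0 ≤ len e) (hHG : H ≤ G) {u v : V}
    (h : H.Reachable u v) : spDist G len u v ≤ spDist H len u v := by
  obtain ⟨w, hw⟩ := exists_walk_eq_spDist hlen h
  rw [← hw]
  simpa using spDist_le_walk hlen (w.mapLe hHG)

lemma abs_spDist_sub_le [Finite V] (hlen : ∀ e, 0 ≤ len e) {r u v : V} (h : G.Reachable r u)
    (h' : G.Reachable u v) : |spDist G len r u - spDist G len r v| ≤ spDist G len u v := by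
  have h1 := spDist_triangle hlen h h'
  have h2 := spDist_triangle hlen (h.trans h') h'.symm
  rw [spDist_comm v u] at h2
  rw [abs_le]
  constructor <;> linarith

/-- Distances to the start of a shortest path are additive along the path. -/
lemma spDist_le_abs_sub_of_mem_support [Finite V] (hlen : ∀ e, 0 ≤ len e) {a b p q : V}
    (w : G.Walk a b) (hw : (w.edges.map len).sum = spDist G len a b) (hp : p ∈ w.support)
    (hq : q ∈ w.support) :
    spDist G len p q ≤ |spDist G len a p - spDist G len a q| := by
  classical
  have h1 := congrArg (fun w : G.Walk a b => (w.edges.map len).sum) (w.take_spec hq)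
  simp only [SimpleGraph.Walk.edges_append, List.map_append, List.sum_append] at h1
  have h3 := spDist_le_walk hlen (w.takeUntil q hq)
  have h4 := spDist_le_walk hlen (w.dropUntil q hq)
  by_cases h : p ∈ (w.takeUntil q hq).support
  · have h2 := congrArg (fun w : G.Walk a q => (w.edges.map len).sum)
      ((w.takeUntil q hq).take_spec h)
    simp only [SimpleGraph.Walk.edges_append, List.map_append, List.sum_append] at h2
    have h5 := spDist_le_walk hlen ((w.takeUntil q hq).takeUntil p h)
    have h6 := spDist_le_walk hlen ((w.takeUntil q hq).dropUntil p h)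
    have h7 := spDist_triangle hlen (w.takeUntil q hq).reachable (w.dropUntil q hq).reachable
    rw [abs_sub_comm]
    refine le_trans ?_ (le_abs_self _)
    linarith
  · have h' : p ∈ (w.dropUntil q hq).support := by
      rw [← w.take_spec hq, SimpleGraph.Walk.mem_support_append_iff] at hp
      exact hp.resolve_left h
    have h2 := congrArg (fun w : G.Walk q b => (w.edges.map len).sum)
      ((w.dropUntil q hq).take_spec h')
    simp only [SimpleGraph.Walk.edges_append, List.map_append, List.sum_append] at h2
    have h5 := spDist_le_walk hlen ((w.dropUntil q hq).takeUntil p h')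
    have h6 := spDist_le_walk hlen ((w.dropUntil q hq).dropUntil p h')
    have h7 := spDist_triangle hlen (w.takeUntil p hp).reachable (w.dropUntil p hp).reachable
    rw [spDist_comm p q]
    refine le_trans ?_ (le_abs_self _)
    linarith

end ShortestPath

section Cuts

variable {V : Type*}

/-- `δ` is the pseudometric induced by a map into a finite-dimensional `ℓ₁`. -/
def IsL1 (δ : V → V → ℝ) : Prop :=
  ∃ (ι : Type) (_ : Fintype ι) (f : V → ι → ℝ), ∀ x y, δ x y = ∑ i, |f x i - f y i|

lemma IsL1.add {δ ε : V → V → ℝ} (hδ : IsL1 δ) (hε : IsL1 ε) :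
    IsL1 fun x y => δ x y + ε x y := by
  obtain ⟨ι, _, f, hf⟩ := hδ
  obtain ⟨κ, _, g, hg⟩ := hε
  exact ⟨ι ⊕ κ, inferInstance, fun x => Sum.elim (f x) (g x), fun x y => by simp [hf, hg]⟩

lemma isL1_abs_sub (g : V → ℝ) : IsL1 fun x y => |g x - g y| :=
  ⟨Unit, inferInstance, fun x _ => g x, fun x y => by simp⟩

lemma IsL1.nonneg {δ : V → V → ℝ} (hδ : IsL1 δ) (x y : V) : 0 ≤ δ x y := by
  obtain ⟨ι, _, f, hf⟩ := hδ
  rw [hf]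
  positivity

lemma IsL1.comm {δ : V → V → ℝ} (hδ : IsL1 δ) (x y : V) : δ x y = δ y x := by
  obtain ⟨ι, _, f, hf⟩ := hδ
  simp only [hf, abs_sub_comm]

lemma IsL1.self {δ : V → V → ℝ} (hδ : IsL1 δ) (x : V) : δ x x = 0 := by
  obtain ⟨ι, _, f, hf⟩ := hδ
  simp [hf]

lemma IsL1.triangle {δ : V → V → ℝ} (hδ : IsL1 δ) (x y z : V) : δ x z ≤ δ x y + δ y z := by
  obtain ⟨ι, _, f, hf⟩ := hδ
  simp only [hf, ← Finset.sum_add_distrib]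
  exact Finset.sum_le_sum fun i _ => abs_sub_le _ _ _

lemma IsL1.c1LE [Fintype V] {δ d : V → V → ℝ} (hδ : IsL1 δ) {κ L : ℝ} (hκ : 0 < κ)
    (hlow : ∀ x y, κ * d x y ≤ δ x y) (hup : ∀ x y, δ x y ≤ L * d x y) : c1LE d (L / κ) := by
  obtain ⟨ι, _, f, hf⟩ := hδ
  have key : ∀ x y, ∑ i, |f x ((Fintype.equivFin ι).symm i) / κ -
      f y ((Fintype.equivFin ι).symm i) / κ| = δ x y / κ := by
    intro x y
    rw [hf, Finset.sum_div, ← (Fintype.equivFin ι).symm.sum_comp]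
    refine Finset.sum_congr rfl fun i _ => ?_
    rw [← sub_div, abs_div, abs_of_pos hκ]
  refine ⟨Fintype.card ι, fun x i => f x ((Fintype.equivFin ι).symm i) / κ, fun x y => ?_⟩
  rw [key]
  constructor
  · rw [le_div_iff₀ hκ, mul_comm]
    exact hlow x y
  · rw [div_mul_eq_mul_div]
    gcongr
    exact hup x y

lemma IsL1.le_mul_spDist [Finite V] {δ : V → V → ℝ} (hδ : IsL1 δ) {G : SimpleGraph V}
    (hG : G.Connected) {len : Sym2 V → ℝ} (hlen : ∀ e, 0 ≤ len e) {L : ℝ}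
    (hL : ∀ u v, G.Adj u v → δ u v ≤ L * len s(u, v)) (u v : V) :
    δ u v ≤ L * spDist G len u v := by
  obtain ⟨w, hw⟩ := exists_walk_eq_spDist hlen (hG.preconnected u v)
  rw [← hw]
  clear hw
  induction w with
  | nil => simp [hδ.self]
  | cons h p ih =>
    simp only [SimpleGraph.Walk.edges_cons, List.map_cons, List.sum_cons, mul_add]
    exact (hδ.triangle _ _ _).trans (add_le_add (hL _ _ h) ih)

end Cuts

section DistTo

variable {V : Type*} {G : SimpleGraph V} {len : Sym2 V → ℝ} {B : Set V}

/-- The distance from a vertex to a set. -/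
noncomputable def distTo (G : SimpleGraph V) (len : Sym2 V → ℝ) (B : Set V) (v : V) : ℝ :=
  ⨅ b : B, spDist G len v b

lemma distTo_nonneg (hlen : ∀ e, 0 ≤ len e) (v : V) : 0 ≤ distTo G len B v :=
  Real.iInf_nonneg fun _ => spDist_nonneg hlen _ _

variable [Finite V]

lemma distTo_le {v b : V} (hb : b ∈ B) : distTo G len B v ≤ spDist G len v b :=
  ciInf_le (Set.finite_range _).bddBelow (⟨b, hb⟩ : B)

lemma exists_spDist_eq_distTo (hB : B.Nonempty) (v : V) :
    ∃ b ∈ B, spDist G len v b = distTo G len B v := by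
  have := hB.to_subtype
  obtain ⟨b, hb⟩ := exists_eq_ciInf_of_finite (f := fun b : B => spDist G len v b)
  exact ⟨b, b.2, hb⟩

lemma distTo_eq_zero (hlen : ∀ e, 0 ≤ len e) {v : V} (hv : v ∈ B) : distTo G len B v = 0 :=
  le_antisymm ((distTo_le hv).trans (spDist_self hlen v).le) (distTo_nonneg hlen v)

lemma distTo_le_add (hG : G.Connected) (hlen : ∀ e, 0 ≤ len e) (hB : B.Nonempty) (u v : V) :
    distTo G len B u ≤ distTo G len B v + spDist G len u v := by
  obtain ⟨b, hb, hvb⟩ := exists_spDist_eq_distTo (G := G) (len := len) hB v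
  have := spDist_triangle hlen (hG.preconnected u v) (hG.preconnected v b)
  linarith [distTo_le (G := G) (len := len) (v := u) hb]

lemma abs_distTo_sub_le (hG : G.Connected) (hlen : ∀ e, 0 ≤ len e) (hB : B.Nonempty) (u v : V) :
    |distTo G len B u - distTo G len B v| ≤ spDist G len u v := by
  have h1 := distTo_le_add hG hlen hB u v
  have h2 := distTo_le_add hG hlen hB v u
  rw [spDist_comm v u] at h2
  rw [abs_le]
  constructor <;> linarith

end DistTo

section Bump

/-- A tent over the point `(2 ^ s, n * 2 ^ (s - 2))` of the half plane. -/
noncomputable def bump (s n : ℤ) (b x : ℝ) : ℝ :=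
  max 0 (min (min (b - 2 ^ s) (2 ^ (s + 3) - b)) (2 ^ s) - |x - n * 2 ^ (s - 2)|)

lemma bump_nonneg (s n : ℤ) (b x : ℝ) : 0 ≤ bump s n b x := le_max_left _ _

lemma bump_le (s n : ℤ) {b : ℝ} (x : ℝ) (hb : 0 ≤ b) : bump s n b x ≤ b := by
  have h1 : (0 : ℝ) < 2 ^ s := by positivity
  have h2 : min (min (b - 2 ^ s) (2 ^ (s + 3) - b)) (2 ^ s) ≤ b - (2 : ℝ) ^ s :=
    (min_le_left _ _).trans (min_le_left _ _)
  exact max_le hb (by linarith [abs_nonneg (x - n * 2 ^ (s - 2))])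

lemma bump_sub_le (s n : ℤ) (b b' x x' : ℝ) :
    bump s n b x - bump s n b' x' ≤ |b - b'| + |x - x'| := by
  have h1 := abs_sub_le x' x (n * 2 ^ (s - 2))
  rw [abs_sub_comm x' x] at h1
  have h2 := le_abs_self (b - b')
  have h3 := neg_abs_le (b - b')
  have h4 := abs_nonneg (x - x')
  have h5 : min (min (b - 2 ^ s) (2 ^ (s + 3) - b)) (2 ^ s) ≤
      min (min (b' - 2 ^ s) (2 ^ (s + 3) - b')) ((2 : ℝ) ^ s) + |b - b'| := by
    rw [← min_add_add_right, ← min_add_add_right]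
    refine min_le_min (min_le_min ?_ ?_) ?_ <;> linarith
  unfold bump
  rw [sub_le_iff_le_add]
  refine max_le ?_ ?_
  · have := le_max_left (0 : ℝ)
      (min (min (b' - 2 ^ s) (2 ^ (s + 3) - b')) (2 ^ s) - |x' - n * 2 ^ (s - 2)|)
    linarith
  · have := le_max_right (0 : ℝ)
      (min (min (b' - 2 ^ s) (2 ^ (s + 3) - b')) (2 ^ s) - |x' - n * 2 ^ (s - 2)|)
    linarith

lemma abs_bump_sub_le (s n : ℤ) (b b' x x' : ℝ) :
    |bump s n b x - bump s n b' x'| ≤ |b - b'| + |x - x'| := by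
  refine abs_sub_le_iff.2 ⟨bump_sub_le s n b b' x x', ?_⟩
  rw [abs_sub_comm b, abs_sub_comm x]
  exact bump_sub_le s n b' b x' x

lemma exists_bump_support (b x : ℝ) :
    ∃ A : Finset (ℤ × ℤ), A.card ≤ 24 ∧ ∀ s n, bump s n b x ≠ 0 → (s, n) ∈ A := by
  let m := Int.log 2 b
  let y : ℤ → ℤ := fun s => ⌊x / 2 ^ (s - 2)⌋
  refine ⟨(Finset.Icc (m - 2) m).biUnion fun s =>
    (Finset.Icc (y s - 3) (y s + 4)).image (Prod.mk s), ?_, fun s n h => ?_⟩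
  · refine (Finset.card_biUnion_le_card_mul _ _ 8 fun s _ =>
      Finset.card_image_le.trans ?_).trans ?_
    · rw [Int.card_Icc]
      omega
    · rw [Int.card_Icc]
      omega
  · have hpos : 0 < min (min (b - 2 ^ s) (2 ^ (s + 3) - b)) (2 ^ s) - |x - n * 2 ^ (s - 2)| := by
      by_contra! hle
      exact h (max_eq_left hle)
    have habs := abs_nonneg (x - n * 2 ^ (s - 2))
    have h1 : |x - n * 2 ^ (s - 2)| < 2 ^ s := by
      linarith [min_le_right (min (b - 2 ^ s) (2 ^ (s + 3) - b)) ((2 : ℝ) ^ s)]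
    have hmin := hpos.trans_le ((sub_le_self _ habs).trans (min_le_left _ _))
    have h2 : (2 : ℝ) ^ s < b := by linarith [hmin.trans_le (min_le_left _ _)]
    have h3 : b < 2 ^ (s + 3) := by linarith [hmin.trans_le (min_le_right _ _)]
    have hb : 0 < b := lt_trans (by positivity) h2
    have h4 : s ≤ m := (Int.zpow_le_iff_le_log one_lt_two hb).1 (by exact_mod_cast h2.le)
    have h5 : m < s + 3 := (Int.lt_zpow_iff_log_lt one_lt_two hb).1 (by exact_mod_cast h3)
    have hS : (2 : ℝ) ^ s = 4 * 2 ^ (s - 2) := by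
      rw [zpow_sub₀ two_ne_zero]
      norm_num
      ring
    have hh : (0 : ℝ) < 2 ^ (s - 2) := by positivity
    obtain ⟨h6, h7⟩ := abs_lt.1 h1
    have h8 : (n : ℝ) - 4 < x / 2 ^ (s - 2) := by
      rw [lt_div_iff₀ hh]
      linarith
    have h9 : x / 2 ^ (s - 2) < n + 4 := by
      rw [div_lt_iff₀ hh]
      linarith
    have h10 : n - 4 ≤ y s := Int.le_floor.2 (by push_cast; exact h8.le)
    have h11 : y s < n + 4 := Int.floor_lt.2 (by push_cast; exact h9)
    simp only [Finset.mem_biUnion, Finset.mem_Icc, Finset.mem_image]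
    exact ⟨s, by omega, n, by omega, rfl⟩

lemma exists_bump_separating {b : ℝ} (hb : 0 < b) (b' x x' : ℝ) :
    ∃ s n, 3 * b / 16 ≤ bump s n b x ∧
      min (3 * b / 16) |x - x'| ≤ bump s n b x - bump s n b' x' := by
  obtain ⟨s, hs⟩ : ∃ s, s = Int.log 2 b - 1 := ⟨_, rfl⟩
  have hh : (0 : ℝ) < 2 ^ (s - 2) := by positivity
  have hS : (2 : ℝ) ^ s = 4 * 2 ^ (s - 2) := by
    rw [zpow_sub₀ two_ne_zero]
    norm_num
    ring
  have hS3 : (2 : ℝ) ^ (s + 3) = 8 * 2 ^ s := by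
    rw [zpow_add₀ two_ne_zero]
    norm_num
    ring
  have h1 : 2 * (2 : ℝ) ^ s ≤ b := by
    have := Int.zpow_log_le_self (R := ℝ) one_lt_two hb
    rw [← sub_add_cancel (Int.log 2 b) 1, ← hs, zpow_add₀ (by norm_num)] at this
    push_cast at this
    linarith
  have h2 : b < 4 * (2 : ℝ) ^ s := by
    have := Int.lt_zpow_succ_log_self (R := ℝ) one_lt_two b
    rw [show Int.log 2 b + 1 = s + 2 by omega, zpow_add₀ (by norm_num)] at this
    push_cast at this
    linarith
  obtain ⟨n, hn1, hn2⟩ : ∃ n : ℤ, |x - n * 2 ^ (s - 2)| ≤ 2 ^ (s - 2) ∧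
      |x' - n * 2 ^ (s - 2)| = |x - n * 2 ^ (s - 2)| + |x - x'| := by
    have key : x = x / 2 ^ (s - 2) * 2 ^ (s - 2) := by field_simp
    rcases le_total x x' with hx | hx
    · refine ⟨⌊x / 2 ^ (s - 2)⌋, ?_⟩
      have h3 := mul_le_mul_of_nonneg_right (Int.floor_le (x / (2 : ℝ) ^ (s - 2))) hh.le
      have h4 := mul_le_mul_of_nonneg_right (Int.lt_floor_add_one (x / (2 : ℝ) ^ (s - 2))).le hh.le
      rw [← key] at h3 h4
      rw [abs_of_nonneg (by linarith), abs_of_nonneg (by linarith), abs_of_nonpos (by linarith)]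
      constructor <;> linarith
    · refine ⟨⌈x / 2 ^ (s - 2)⌉, ?_⟩
      have h3 := mul_le_mul_of_nonneg_right (Int.le_ceil (x / (2 : ℝ) ^ (s - 2))) hh.le
      have h4 := mul_le_mul_of_nonneg_right (Int.ceil_lt_add_one (x / (2 : ℝ) ^ (s - 2))).le hh.le
      rw [← key] at h3
      rw [add_mul, ← key] at h4
      rw [abs_of_nonpos (by linarith), abs_of_nonpos (by linarith), abs_of_nonneg (by linarith)]
      constructor <;> linarith
  have h3 : (2 : ℝ) ^ s - |x - n * 2 ^ (s - 2)| ≤ bump s n b x := by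
    refine le_trans ?_ (le_max_right _ _)
    gcongr
    refine le_min (le_min ?_ ?_) le_rfl <;> linarith
  have h4 : bump s n b' x' ≤ max 0 (2 ^ s - |x - n * 2 ^ (s - 2)| - |x - x'|) := by
    refine max_le_max le_rfl ?_
    rw [hn2, ← sub_sub]
    gcongr
    exact min_le_right _ _
  refine ⟨s, n, by linarith, ?_⟩
  rcases max_cases 0 ((2 : ℝ) ^ s - |x - n * 2 ^ (s - 2)| - |x - x'|) with ⟨h, -⟩ | ⟨h, -⟩
  · refine (min_le_left _ _).trans ?_
    linarith
  · refine (min_le_right _ _).trans ?_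
    linarith

end Bump

section Avoid

variable {V : Type*} {G : SimpleGraph V} {B : Set V}

/-- The subgraph of `G` in which all vertices of `B` are isolated. -/
def avoid (G : SimpleGraph V) (B : Set V) : SimpleGraph V where
  Adj u v := G.Adj u v ∧ u ∉ B ∧ v ∉ B
  symm := ⟨fun _ _ h => ⟨h.1.symm, h.2.2, h.2.1⟩⟩
  loopless := ⟨fun _ h => h.1.ne rfl⟩

lemma avoid_le (G : SimpleGraph V) (B : Set V) : avoid G B ≤ G := fun _ _ h => h.1

lemma avoid_anti {B' : Set V} (h : B ⊆ B') : avoid G B' ≤ avoid G B :=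
  fun _ _ h' => ⟨h'.1, fun hu => h'.2.1 (h hu), fun hv => h'.2.2 (h hv)⟩

lemma eq_of_reachable_avoid {u v : V} (h : (avoid G B).Reachable u v) (hu : u ∈ B) : u = v := by
  obtain ⟨w⟩ := h
  cases w with
  | nil => rfl
  | cons h _ => exact absurd hu h.2.1

lemma notMem_of_reachable_avoid {u v : V} (h : (avoid G B).Reachable u v) (hu : u ∉ B) :
    v ∉ B := fun hv => hu (eq_of_reachable_avoid h.symm hv ▸ hv)

lemma reachable_avoid_of_spDist_lt [Finite V] {len : Sym2 V → ℝ} (hlen : ∀ e, 0 ≤ len e)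
    (hG : G.Connected) {u p : V} (h : spDist G len u p < distTo G len B u) :
    (avoid G B).Reachable u p ∧ spDist (avoid G B) len u p ≤ spDist G len u p := by
  classical
  obtain ⟨w, hw⟩ := exists_walk_eq_spDist hlen (hG.preconnected u p)
  have hB : ∀ q ∈ w.support, q ∉ B := by
    intro q hq hqB
    have h1 := congrArg (fun w : G.Walk u p => (w.edges.map len).sum) (w.take_spec hq)
    simp only [SimpleGraph.Walk.edges_append, List.map_append, List.sum_append] at h1
    have h2 := spDist_le_walk hlen (w.takeUntil q hq)
    have h3 := sum_map_len_nonneg hlen (w.dropUntil q hq).edges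
    have h4 := distTo_le (G := G) (len := len) (v := u) hqB
    linarith
  have hE : ∀ e ∈ w.edges, e ∈ (avoid G B).edgeSet := by
    intro e he
    induction e with
    | h x y =>
      exact ⟨w.adj_of_mem_edges he, hB _ (w.fst_mem_support_of_mem_edges he),
        hB _ (w.snd_mem_support_of_mem_edges he)⟩
  refine ⟨(w.transfer _ hE).reachable, ?_⟩
  rw [← hw, ← w.edges_transfer hE]
  exact spDist_le_walk hlen _

lemma exists_mem_support_of_le {H : SimpleGraph V} {l r : V → ℕ}
    (h : ∀ u v, H.Adj u v → l u ≤ r v) {a b : V} (w : H.Walk a b) {t : ℕ} (ha : l a ≤ t)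
    (hb : t ≤ r b) : ∃ p ∈ w.support, l p ≤ t ∧ t ≤ r p := by
  induction w with
  | nil => exact ⟨_, SimpleGraph.Walk.start_mem_support _, ha, hb⟩
  | @cons a v b hav w ih =>
    by_cases hta : t ≤ r a
    · exact ⟨a, SimpleGraph.Walk.start_mem_support _, ha, hta⟩
    · obtain ⟨p, hp, hpt⟩ := ih ((h v a hav.symm).trans (not_le.1 hta).le) hb
      exact ⟨p, by simp [hp], hpt⟩

/-- Within each component of `avoid G B`, at most `m` intervals share a point. -/
def Overlap (G : SimpleGraph V) (l r : V → ℕ) (B : Set V) (m : ℕ) : Prop :=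
  ∀ v t, {u | (avoid G B).Reachable v u ∧ u ∉ B ∧ l u ≤ t ∧ t ≤ r u}.ncard ≤ m

/-- The set `B` can be enlarged by one geodesic in each component of `avoid G B` so that the
overlap drops. -/
lemma exists_next [Finite V] {len : Sym2 V → ℝ} (hlen : ∀ e, 0 ≤ len e) {l r : V → ℕ}
    (hrep : ∀ u v, G.Adj u v → l u ≤ r v) (B : Set V) :
    ∃ (B' : Set V) (root : V → V), B ⊆ B' ∧
      (∀ v, (avoid G B).Reachable (root v) v) ∧
      (∀ u v, (avoid G B).Reachable u v → root u = root v) ∧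
      (∀ p ∈ B', ∀ q ∈ B', (avoid G B).Reachable p q → spDist (avoid G B) len p q ≤
        |spDist (avoid G B) len (root p) p - spDist (avoid G B) len (root q) q|) ∧
      ∀ m, Overlap G l r B (m + 1) → Overlap G l r B' m := by
  classical
  set H := avoid G B
  have key : ∀ K : H.ConnectedComponent, ∃ (a b : V) (w : H.Walk a b),
      H.connectedComponentMk a = K ∧ (∀ v, H.connectedComponentMk v = K → l a ≤ l v) ∧
      (∀ v, H.connectedComponentMk v = K → r v ≤ r b) ∧
      (w.edges.map len).sum = spDist H len a b := by
    intro K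
    obtain ⟨x, hx⟩ := K.exists_rep
    have hne : {v | H.connectedComponentMk v = K}.Nonempty := ⟨x, hx⟩
    obtain ⟨a, ha, hla⟩ := Set.exists_min_image _ l (Set.toFinite _) hne
    obtain ⟨b, hb, hrb⟩ := Set.exists_max_image _ r (Set.toFinite _) hne
    obtain ⟨w, hw⟩ := exists_walk_eq_spDist hlen
      (SimpleGraph.ConnectedComponent.exact (ha.trans hb.symm))
    exact ⟨a, b, w, ha, hla, hrb, hw⟩
  choose a b w ha hla hrb hw using key
  have hroot : ∀ v, H.Reachable (a (H.connectedComponentMk v)) v :=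
    fun v => SimpleGraph.ConnectedComponent.exact (ha _)
  obtain ⟨B', hmem⟩ : ∃ B' : Set V, ∀ v K, H.connectedComponentMk v = K →
      (v ∈ B' ↔ v ∈ (w K).support) :=
    ⟨{v | v ∈ (w (H.connectedComponentMk v)).support}, fun v K h => h ▸ Iff.rfl⟩
  have hBB' : B ⊆ B' := by
    intro v hv
    rw [hmem v _ rfl]
    convert (w (H.connectedComponentMk v)).start_mem_support
    exact eq_of_reachable_avoid (hroot v).symm hv
  refine ⟨B', fun v => a (H.connectedComponentMk v), hBB', hroot, ?_, ?_, ?_⟩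
  · intro u v huv
    simp only [SimpleGraph.ConnectedComponent.sound huv]
  · intro p hp q hq hpq
    have hK := SimpleGraph.ConnectedComponent.sound hpq
    rw [hmem p _ hK] at hp
    rw [hmem q _ rfl] at hq
    simp only [hK]
    exact spDist_le_abs_sub_of_mem_support hlen _ (hw _) hp hq
  · intro m hm v t
    rcases Set.eq_empty_or_nonempty {u | (avoid G B').Reachable v u ∧ u ∉ B' ∧ l u ≤ t ∧ t ≤ r u}
      with h | ⟨u, hvu, hu, hlu, hru⟩
    · rw [h, Set.ncard_empty]
      exact Nat.zero_le m
    have hvB : v ∉ B := fun h => notMem_of_reachable_avoid hvu.symm hu (hBB' h)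
    have huv : H.connectedComponentMk u = H.connectedComponentMk v :=
      SimpleGraph.ConnectedComponent.sound (hvu.mono (avoid_anti hBB')).symm
    obtain ⟨p, hp, hpt⟩ := exists_mem_support_of_le
      (fun u v h => hrep u v (avoid_le G B h))
      (w (H.connectedComponentMk v)) ((hla _ u huv).trans hlu) (hru.trans (hrb _ u huv))
    have hvp : H.Reachable v p := (hroot v).symm.trans (SimpleGraph.Walk.takeUntil _ p hp).reachable
    refine Nat.lt_succ_iff.1 (lt_of_lt_of_le (Set.ncard_lt_ncard ?_ (Set.toFinite _)) (hm v t))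
    refine (Set.ssubset_iff_of_subset ?_).2 ⟨p, ⟨hvp, notMem_of_reachable_avoid hvp hvB, hpt⟩, ?_⟩
    · rintro x ⟨hvx, hx, hxt⟩
      exact ⟨hvx.mono (avoid_anti hBB'), fun h => hx (hBB' h), hxt⟩
    · rintro ⟨-, hp', -⟩
      exact hp' ((hmem p _ (SimpleGraph.ConnectedComponent.sound hvp.symm)).2 hp)

end Avoid

section Embedding

variable {V : Type} [Finite V] {G : SimpleGraph V} {len : Sym2 V → ℝ} {B : Set V}

lemma exists_tent (hG : G.Connected) (hlen : ∀ e, 0 ≤ len e) (hB : B.Nonempty) {root : V → V}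
    (hroot : ∀ v, (avoid G B).Reachable (root v) v)
    (hroot' : ∀ u v, (avoid G B).Reachable u v → root u = root v) :
    ∃ δ : V → V → ℝ, IsL1 δ ∧ (∀ u v, G.Adj u v → δ u v ≤ 96 * len s(u, v)) ∧
      ∀ u v, 0 < distTo G len B u →
        (¬ (avoid G B).Reachable u v → 3 * distTo G len B u / 16 ≤ δ u v) ∧
        ((avoid G B).Reachable u v → min (3 * distTo G len B u / 16)
          |spDist (avoid G B) len (root u) u - spDist (avoid G B) len (root v) v| ≤ δ u v) := by
  classical
  have := Fintype.ofFinite V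
  set β := distTo G len B
  set x : V → ℝ := fun v => spDist (avoid G B) len (root v) v with hx
  have hβ0 : ∀ v, 0 ≤ β v := distTo_nonneg hlen
  choose A hA hAmem using fun v => exists_bump_support (β v) (x v)
  let φ : V → V × ℤ × ℤ → ℝ := fun v i =>
    if root v = i.1 then bump i.2.1 i.2.2 (β v) (x v) else 0
  have hφ0 : ∀ v i, 0 ≤ φ v i := by
    intro v i
    simp only [φ]
    split_ifs
    exacts [bump_nonneg _ _ _ _, le_rfl]
  have hφβ : ∀ v i, φ v i ≤ β v := by
    intro v i
    simp only [φ]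
    split_ifs
    exacts [bump_le _ _ _ (hβ0 v), hβ0 v]
  let S : V → Finset (V × ℤ × ℤ) := fun v => (A v).image (Prod.mk (root v))
  have hS : ∀ v, (S v).card ≤ 24 := fun v => Finset.card_image_le.trans (hA v)
  have hφS : ∀ v i, i ∉ S v → φ v i = 0 := by
    intro v i hi
    by_contra h
    simp only [φ, ite_eq_right_iff, Classical.not_imp] at h
    exact hi (Finset.mem_image.2 ⟨i.2, hAmem v _ _ h.2, by rw [h.1]⟩)
  let I : Finset (V × ℤ × ℤ) := Finset.univ.biUnion S
  have hSI : ∀ v, S v ⊆ I := fun v => Finset.subset_biUnion_of_mem S (Finset.mem_univ v)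
  have hcoord : ∀ u v i, |φ u i - φ v i| ≤ ∑ i ∈ I, |φ u i - φ v i| := by
    intro u v i
    by_cases hi : i ∈ I
    · exact Finset.single_le_sum (f := fun i => |φ u i - φ v i|) (fun i _ => abs_nonneg _) hi
    · rw [hφS u i fun h => hi (hSI u h), hφS v i fun h => hi (hSI v h), sub_self, abs_zero]
      exact Finset.sum_nonneg fun i _ => abs_nonneg _
  refine ⟨fun u v => ∑ i ∈ I, |φ u i - φ v i|, ⟨I, inferInstance, fun v i => φ v i, fun u v =>
    (Finset.sum_coe_sort I fun i => |φ u i - φ v i|).symm⟩, fun u v huv => ?_, fun u v hu => ?_⟩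
  · have hlen' := hlen s(u, v)
    have hβuv : |β u - β v| ≤ len s(u, v) :=
      (abs_distTo_sub_le hG hlen hB u v).trans (spDist_le_len hlen huv)
    have hterm : ∀ i, |φ u i - φ v i| ≤ 2 * len s(u, v) := by
      intro i
      obtain ⟨h1, h2⟩ := abs_le.1 hβuv
      have h3 := hφ0 u i
      have h4 := hφ0 v i
      have h5 := hφβ u i
      have h6 := hφβ v i
      by_cases hu : u ∈ B
      · have h7 : β u = 0 := distTo_eq_zero hlen hu
        rw [abs_le]
        constructor <;> linarith
      by_cases hv : v ∈ B
      · have h7 : β v = 0 := distTo_eq_zero hlen hv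
        rw [abs_le]
        constructor <;> linarith
      have hadj : (avoid G B).Adj u v := ⟨huv, hu, hv⟩
      have hr := hroot' u v hadj.reachable
      simp only [φ, hr]
      split_ifs
      · refine (abs_bump_sub_le _ _ _ _ _ _).trans ?_
        have h7 : |x u - x v| ≤ len s(u, v) := by
          simp only [hx, hr]
          exact (abs_spDist_sub_le hlen (hr ▸ hroot u) hadj.reachable).trans
            (spDist_le_len hlen hadj)
        linarith
      · simp only [sub_self, abs_zero]
        linarith
    calc ∑ i ∈ I, |φ u i - φ v i| = ∑ i ∈ S u ∪ S v, |φ u i - φ v i| := by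
          refine (Finset.sum_subset (Finset.union_subset (hSI u) (hSI v)) fun i _ hi => ?_).symm
          rw [Finset.mem_union, not_or] at hi
          rw [hφS u i hi.1, hφS v i hi.2, sub_self, abs_zero]
      _ ≤ (S u ∪ S v).card • (2 * len s(u, v)) := Finset.sum_le_card_nsmul _ _ _ fun i _ => hterm i
      _ ≤ 48 * (2 * len s(u, v)) := by
          rw [nsmul_eq_mul]
          gcongr
          exact_mod_cast (Finset.card_union_le _ _).trans (add_le_add (hS u) (hS v))
      _ = 96 * len s(u, v) := by ring
  · obtain ⟨s, n, h1, h2⟩ := exists_bump_separating hu (β v) (x u) (x v)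
    have h3 := (le_abs_self _).trans (hcoord u v (root u, s, n))
    refine ⟨fun huv => ?_, fun huv => ?_⟩
    · have hr : root v ≠ root u := by
        intro h
        exact huv ((hroot u).symm.trans (h ▸ hroot v))
      simp only [φ, if_true, if_neg hr, sub_zero] at h3
      exact h1.trans h3
    · simp only [φ, if_true, if_pos (hroot' u v huv).symm] at h3
      exact h2.trans h3

/-- Some `ℓ₁` pseudometric is `L`-Lipschitz along edges and separates those pairs whose distance
is large compared to the distance to `B`. -/
def Good (G : SimpleGraph V) (len : Sym2 V → ℝ) (B : Set V) (L c κ : ℝ) : Prop :=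
  ∃ δ : V → V → ℝ, IsL1 δ ∧ (∀ u v, G.Adj u v → δ u v ≤ L * len s(u, v)) ∧
    ∀ u v, distTo G len B u ≤ c * spDist G len u v → κ * spDist G len u v ≤ δ u v

lemma good_singleton (hG : G.Connected) (hlen : ∀ e, 0 ≤ len e) (a : V) :
    Good G len {a} 1 (1 / 4) (1 / 2) := by
  have hd : ∀ v, distTo G len {a} v = spDist G len v a := by
    intro v
    obtain ⟨b, rfl, hb⟩ := exists_spDist_eq_distTo (G := G) (len := len)
      (Set.singleton_nonempty a) v
    exact hb.symm
  refine ⟨_, isL1_abs_sub (distTo G len {a}), fun u v huv => ?_, fun u v huv => ?_⟩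
  · rw [one_mul]
    exact (abs_distTo_sub_le hG hlen (Set.singleton_nonempty a) u v).trans
      (spDist_le_len hlen huv)
  · rw [hd] at huv
    simp only [hd]
    have h1 := spDist_triangle hlen (hG.preconnected u a) (hG.preconnected a v)
    rw [spDist_comm a v] at h1
    have h2 := neg_abs_le (spDist G len u a - spDist G len v a)
    linarith

lemma Good.next (hG : G.Connected) (hlen : ∀ e, 0 ≤ len e) (hB : B.Nonempty) {B' : Set V}
    {root : V → V} (hBB' : B ⊆ B') (hroot : ∀ v, (avoid G B).Reachable (root v) v)
    (hroot' : ∀ u v, (avoid G B).Reachable u v → root u = root v)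
    (hgeod : ∀ p ∈ B', ∀ q ∈ B', (avoid G B).Reachable p q → spDist (avoid G B) len p q ≤
      |spDist (avoid G B) len (root p) p - spDist (avoid G B) len (root q) q|)
    {L c κ : ℝ} (hc : 0 < c) (hc' : c ≤ 1 / 4) (h : Good G len B L c κ) :
    Good G len B' (L + 97) (c / 20) (min κ (c / 20)) := by
  obtain ⟨δ, hδ, hδL, hδκ⟩ := h
  obtain ⟨ε, hε, hεL, hεκ⟩ := exists_tent hG hlen hB hroot hroot'
  have hB' := hB.mono hBB'
  refine ⟨_, (hδ.add (isL1_abs_sub (distTo G len B'))).add hε, fun u v huv => ?_,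
    fun u v huv => ?_⟩
  · have h1 := (abs_distTo_sub_le hG hlen hB' u v).trans (spDist_le_len hlen huv)
    linarith [hδL u v huv, hεL u v huv]
  have hδ0 := hδ.nonneg u v
  have hε0 := hε.nonneg u v
  have hβ0 := abs_nonneg (distTo G len B' u - distTo G len B' v)
  have hD0 := spDist_nonneg (G := G) hlen u v
  have hmin1 := mul_le_mul_of_nonneg_right (min_le_left κ (c / 20)) hD0
  have hmin2 := mul_le_mul_of_nonneg_right (min_le_right κ (c / 20)) hD0
  by_cases h1 : distTo G len B u ≤ c * spDist G len u v
  · linarith [hδκ u v h1]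
  by_cases h2 : distTo G len B v ≤ c * spDist G len u v
  · have h3 := hδκ v u (by rwa [spDist_comm v u])
    rw [spDist_comm v u, hδ.comm v u] at h3
    linarith
  have hcD : 0 ≤ c * spDist G len u v := by positivity
  by_cases h3 : 2 * (c / 20) * spDist G len u v ≤ distTo G len B' v
  · linarith [neg_abs_le (distTo G len B' u - distTo G len B' v)]
  push Not at h1 h2 h3
  obtain ⟨p, hp, hup⟩ := exists_spDist_eq_distTo (G := G) (len := len) hB' u
  obtain ⟨q, hq, hvq⟩ := exists_spDist_eq_distTo (G := G) (len := len) hB' v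
  obtain ⟨hup1, hup2⟩ := reachable_avoid_of_spDist_lt hlen hG
    (show spDist G len u p < distTo G len B u by linarith)
  obtain ⟨hvq1, hvq2⟩ := reachable_avoid_of_spDist_lt hlen hG
    (show spDist G len v q < distTo G len B v by linarith)
  obtain ⟨h4, h5⟩ := hεκ u v (by linarith)
  by_cases h6 : (avoid G B).Reachable u v
  · have hpq : (avoid G B).Reachable p q := hup1.symm.trans (h6.trans hvq1)
    have e1 := hgeod p hp q hq hpq
    have e2 := spDist_anti hlen (avoid_le G B) h6
    have e3 := spDist_triangle hlen hup1 (hpq.trans hvq1.symm)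
    have e4 := spDist_triangle hlen hpq hvq1.symm
    rw [spDist_comm q v] at e4
    have e5 := abs_spDist_sub_le hlen (hroot u) hup1
    have e6 := abs_spDist_sub_le hlen (hroot v) hvq1
    rw [hroot' u p hup1] at e5
    rw [hroot' v q hvq1] at e6
    have h7 := h5 h6
    rw [hroot' u p hup1, hroot' v q hvq1] at h7
    have e7 := abs_sub_le (spDist (avoid G B) len (root p) p) (spDist (avoid G B) len (root p) u)
      (spDist (avoid G B) len (root q) q)
    have e8 := abs_sub_le (spDist (avoid G B) len (root p) u) (spDist (avoid G B) len (root q) v)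
      (spDist (avoid G B) len (root q) q)
    rw [abs_sub_comm _ (spDist (avoid G B) len (root p) u)] at e7
    have e9 : c * spDist G len u v ≤ 1 / 4 * spDist G len u v := by gcongr
    have e10 : c / 20 * spDist G len u v ≤ min (3 * distTo G len B u / 16)
        |spDist (avoid G B) len (root p) u - spDist (avoid G B) len (root q) v| :=
      le_min (by linarith) (by linarith)
    linarith
  · have h7 := h4 h6
    linarith

lemma exists_good (j : ℕ) : ∃ L c κ : ℝ, 0 < c ∧ c ≤ 1 / 4 ∧ 0 < κ ∧
    ∀ (V : Type) [Finite V] (G : SimpleGraph V), G.Connected → ∀ len : Sym2 V → ℝ,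
    (∀ e, 0 ≤ len e) → ∀ l r : V → ℕ, (∀ u v, G.Adj u v → l u ≤ r v) →
    ∀ m, (∀ t, {v | l v ≤ t ∧ t ≤ r v}.ncard ≤ m + j) →
    ∃ B : Set V, B.Nonempty ∧ Overlap G l r B m ∧ Good G len B L c κ := by
  induction j with
  | zero =>
    refine ⟨1, 1 / 4, 1 / 2, by norm_num, le_rfl, by norm_num, ?_⟩
    intro V _ G hG len hlen l r hrep m hm
    obtain ⟨a⟩ := hG.nonempty
    refine ⟨{a}, Set.singleton_nonempty a, fun v t => ?_, good_singleton hG hlen a⟩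
    exact (Set.ncard_le_ncard (fun u hu => hu.2.2) (Set.toFinite _)).trans (hm t)
  | succ j ih =>
    obtain ⟨L, c, κ, hc, hc', hκ, ih⟩ := ih
    refine ⟨L + 97, c / 20, min κ (c / 20), by positivity, by linarith,
      lt_min hκ (by positivity), ?_⟩
    intro V _ G hG len hlen l r hrep m hm
    obtain ⟨B, hB, hover, hgood⟩ := ih V G hG len hlen l r hrep (m + 1) fun t =>
      (hm t).trans (by omega)
    obtain ⟨B', root, hBB', h1, h2, h3, h4⟩ := exists_next hlen hrep B
    exact ⟨B', hB.mono hBB', h4 m hover, hgood.next hG hlen hB hBB' h1 h2 h3 hc hc'⟩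

lemma exists_c1LE_of_isIntervalRep (m : ℕ) : ∃ c : ℝ, ∀ (V : Type) [Fintype V]
    (G : SimpleGraph V), G.Connected → ∀ len : Sym2 V → ℝ, (∀ e, 0 ≤ len e) →
    ∀ l r : V → ℕ, IsIntervalRep G l r m → c1LE (spDist G len) c := by
  obtain ⟨L, c, κ, hc, -, hκ, h⟩ := exists_good m
  refine ⟨L / κ, fun V _ G hG len hlen l r hrep => ?_⟩
  obtain ⟨B, -, hover, δ, hδ, hδL, hδκ⟩ := h V G hG len hlen l r hrep.adj 0 fun t => by
    simpa using hrep.card_le t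
  refine hδ.c1LE hκ (fun u v => hδκ u v ?_) (hδ.le_mul_spDist hG hlen hδL)
  have hu : u ∈ B := by
    by_contra hu
    have h1 := Nat.le_zero.1 (hover u (l u))
    rw [Set.ncard_eq_zero] at h1
    exact (h1 ▸ (⟨.refl u, hu, le_rfl, hrep.le u⟩ :
      u ∈ {x | (avoid G B).Reachable u x ∧ x ∉ B ∧ l x ≤ l u ∧ l u ≤ r x}) : u ∈ (∅ : Set V))
  rw [distTo_eq_zero hlen hu]
  exact mul_nonneg hc.le (spDist_nonneg hlen u v)

end Embedding

/-- **Theorem (Lee–Sidiropoulos).** If `F` is a minor-closed family of finite graphs that does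
not contain every tree, then `c₁(F) < ∞`: there is a constant `c` such that every shortest-path
metric supported on a graph of `F` embeds into `L₁` with distortion at most `c` (equivalently,
the multicommodity max-flow/min-cut gap of `F` is uniformly bounded). -/
theorem pathwidth_gnrs (F : GraphFamily)
    (hminor : ∀ (m n : ℕ) (H : SimpleGraph (Fin m)) (G : SimpleGraph (Fin n)),
      G ∈ F n → IsMinor H G → H ∈ F m)
    (htree : ∃ (n : ℕ) (T : SimpleGraph (Fin n)), T.IsTree ∧ T ∉ F n) :
    ∃ c : ℝ, ∀ Y ∈ SupportedMetrics F, c1LE Y.2 c := by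
  obtain ⟨n, T, hT, hTF⟩ := htree
  obtain ⟨c, hc⟩ := exists_c1LE_of_isIntervalRep (n + 1)
  refine ⟨c, ?_⟩
  rintro ⟨k, d⟩ ⟨G, hGF, hG, len, hlen, hd⟩
  obtain ⟨l, r, hrep⟩ := exists_isIntervalRep G T hT fun h => hTF (hminor _ _ _ _ hGF h)
  have hd' : d = spDist G len := funext fun u => funext (hd u)
  rw [hd']
  exact hc _ G hG len hlen l r hrep
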